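/- W 8 17 0 and ¬ W 7 17 0; that is, q₁(17) = 8. (In contrast, the smallest q for which there exists ℓ with 17 ≤ 2^ℓ and 2^ℓ · (q+1) ≤ 2^q is 9, so n = 17 is the smallest value where the simple strategy of Theorem 2 is not optimal.) -/

import Mathlib

/-- `W j a b` : the questioner can force a win within `j` questions from
state `(a, b)` (a = candidates fitting all answers, b = candidates fitting
all but exactly one answer) in Ulam's liar game with one lie. -/
def W : ℕ → ℕ → ℕ → Prop
  | 0, a, b => a + b ≤ 1
  | (j+1), a, b => ∃ a₁ a₂ b₁ b₂ : ℕ, a₁ + a₂ = a ∧ b₁ + b₂ = b ∧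
      W j a₁ (b₁ + a₂) ∧ W j a₂ (b₂ + a₁)

/-- The volume bound: a state that can be won in `j` questions has weight at most `2 ^ j`. -/
theorem W.weight_le {j a b : ℕ} (h : W j a b) : a * (j + 1) + b ≤ 2 ^ j := by
  induction j generalizing a b with
  | zero => simpa [W] using h
  | succ j ih =>
    obtain ⟨a₁, a₂, b₁, b₂, rfl, rfl, h₁, h₂⟩ := h
    have := ih h₁
    have := ih h₂
    rw [pow_succ]
    linarith

theorem W_zero_left {j b : ℕ} (h : b ≤ 2 ^ j) : W j 0 b := by
  induction j generalizing b with
  | zero => simpa [W] using h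
  | succ j ih =>
    rw [pow_succ] at h
    exact ⟨0, 0, b / 2, b - b / 2, by omega, by omega, ih (by omega), ih (by omega)⟩

theorem W_one_left {j b : ℕ} (h : b + (j + 1) ≤ 2 ^ j) : W j 1 b := by
  induction j generalizing b with
  | zero => simp [W] at h ⊢; omega
  | succ j ih =>
    have hj : j < 2 ^ j := Nat.lt_two_pow_self
    rw [pow_succ] at h
    exact ⟨1, 0, b - (2 ^ j - 1), min b (2 ^ j - 1), by omega, by omega,
      ih (by omega), W_zero_left (by omega)⟩

theorem W_two_left {j b : ℕ} (h : b + (2 * j + 5) ≤ 2 ^ (j + 1)) : W (j + 1) 2 b := by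
  rw [pow_succ] at h
  exact ⟨1, 1, b / 2, b - b / 2, by omega, by omega,
    W_one_left (by omega), W_one_left (by omega)⟩

theorem W_six_four {b : ℕ} (h : b ≤ 13) : W 6 4 b :=
  ⟨2, 2, b / 2, b - b / 2, by omega, by omega, W_two_left (by omega), W_two_left (by omega)⟩

theorem W_five_three_two : W 5 3 2 :=
  ⟨1, 2, 2, 0, rfl, rfl, W_one_left (by norm_num), W_two_left (by norm_num)⟩

theorem W_six_five_four : W 6 5 4 :=
  ⟨2, 3, 4, 0, rfl, rfl, W_two_left (by norm_num), W_five_three_two⟩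

theorem W_seven_nine_eight : W 7 9 8 :=
  ⟨4, 5, 8, 0, rfl, rfl, W_six_four (by norm_num), W_six_five_four⟩

theorem W_seven_eight_nine : W 7 8 9 :=
  ⟨4, 4, 5, 4, rfl, rfl, W_six_four (by norm_num), W_six_four (by norm_num)⟩

theorem ulam_seventeen : W 8 17 0 ∧ ¬ W 7 17 0 := by
  refine ⟨⟨9, 8, 0, 0, rfl, rfl, W_seven_nine_eight, W_seven_eight_nine⟩, fun h => ?_⟩
  have := h.weight_le
  norm_num at this
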